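/- arXiv:1210.0845 — 5 statements merged into one kernel-verified Lean document; each statement's English description precedes it below -/
import Mathlib

section
/- Let G be a weighted complete graph on vertex set [n] = {1,…,n} with edge-weight function w, let i, j ∈ [n] be distinct, let r ≥ 2, and let i₁,…,i_r ∈ [n] ∖ {i,j} be pairwise distinct. Then w(i,i₁,…,i_r,j) = (1/2)·( w(i,i₁,i_r,j) − w(i,i_r,i₁,j) + ∑_{s=1}^{r−1} ( w(i,i_s,i_{s+1},j) + w(i,i_{s+1},i_s,j) ) ) − ∑_{s=2}^{r−1} w(i,i_s,j), where w(v₀,…,v_t) denotes the weight of the simple path with vertex sequence (v₀,…,v_t). -/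
/-- The weight of a path, given as the list of its vertices: the sum of the weights of
consecutive pairs of vertices. -/
def pathWeight {n : ℕ} (w : Fin n → Fin n → ℝ) : List (Fin n) → ℝ
  | a :: b :: rest => w a b + pathWeight w (b :: rest)
  | _ => 0

/-- `p` is (the vertex list of) a simple path between `i` and `j`: its vertices are pairwise
distinct, it starts at `i` and ends at `j`. -/
def IsPath {n : ℕ} (i j : Fin n) (p : List (Fin n)) : Prop :=
  p.Nodup ∧ p.head? = some i ∧ p.getLast? = some j

/-- `Nn n = ∑_{k=1}^{n-1} (n-2)!/(n-1-k)!`, the number of simple paths between two fixed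
distinct vertices of the complete graph `K_n`. -/
def Nn (n : ℕ) : ℕ := ∑ k ∈ Finset.Icc 1 (n - 1), Nat.factorial (n - 2) / Nat.factorial (n - 1 - k)

noncomputable instance {n : ℕ} (i j : Fin n) : Fintype {p : List (Fin n) // IsPath i j p} :=
  Fintype.ofInjective (fun p => (⟨p.1, p.2.1⟩ : {l : List (Fin n) // l.Nodup}))
    (by intro p q h; cases p; cases q; simpa [Subtype.ext_iff] using h)

/-- The finite set of (vertex lists of) simple paths between `i` and `j` in `K_n`. -/
noncomputable def pathFinset (n : ℕ) (i j : Fin n) : Finset (List (Fin n)) :=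
  (Finset.univ : Finset {p : List (Fin n) // IsPath i j p}).map
    ⟨Subtype.val, Subtype.val_injective⟩

/-- `DG n w i j` is the multiset of the weights of all simple paths between `i` and `j`. -/
noncomputable def DG (n : ℕ) (w : Fin n → Fin n → ℝ) (i j : Fin n) : Multiset ℝ :=
  (pathFinset n i j).val.map (pathWeight w)

/-- `hMultiset n y u v` is the multiset of all sums
`y u i₁ + y i₁ i₂ + ⋯ + y i_{r-1} i_r + y i_r v` over `r ≥ 0` and pairwise distinct
`i₁, …, i_r ∈ [n] ∖ {u,v}`. -/
noncomputable def hMultiset (n : ℕ) (y : Fin n → Fin n → ℝ) (u v : Fin n) : Multiset ℝ :=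
  (pathFinset n u v).val.map (pathWeight y)

theorem pathWeight_append_pair {n : ℕ} (w : Fin n → Fin n → ℝ) (l : List (Fin n)) (a b : Fin n) :
    pathWeight w (l ++ [a, b]) = pathWeight w (l ++ [a]) + w a b := by
  induction l with
  | nil => simp [pathWeight]
  | cons x l ih =>
    cases l with
    | nil => simp [pathWeight]
    | cons y l =>
      simp only [List.cons_append, pathWeight] at ih ⊢
      rw [ih]
      ring

theorem pathWeight_append_singleton_map_range {n : ℕ} (w : Fin n → Fin n → ℝ) (i : Fin n)
    (e : ℕ → Fin n) (k : ℕ) :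
    pathWeight w ([i] ++ (List.range (k + 1)).map e) =
      w i (e 0) + ∑ s ∈ Finset.range k, w (e s) (e (s + 1)) := by
  induction k with
  | zero => simp [pathWeight]
  | succ k ih =>
    have h : [i] ++ (List.range (k + 1 + 1)).map e =
        ([i] ++ (List.range k).map e) ++ [e k, e (k + 1)] := by
      simp [List.range_succ]
    have h' : ([i] ++ (List.range k).map e) ++ [e k] = [i] ++ (List.range (k + 1)).map e := by
      simp [List.range_succ]
    rw [h, pathWeight_append_pair, h', ih, Finset.sum_range_succ]
    ring

theorem sum_range_add_succ (c : ℕ → ℝ) (m : ℕ) :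
    ∑ s ∈ Finset.range (m + 1), (c s + c (s + 1)) =
      c 0 + c (m + 1) + 2 * ∑ s ∈ Finset.Icc 1 m, c s := by
  induction m with
  | zero => simp
  | succ m ih =>
    rw [Finset.sum_range_succ, ih, Finset.sum_Icc_succ_top (by omega)]
    ring

/-- In a weighted complete graph on `[n]`, for distinct `i, j`, `r ≥ 2` and
pairwise distinct `i₁, …, i_r ∈ [n] ∖ {i,j}` (here `i_{s+1} = e s` for `s < r`),
`w(i,i₁,…,i_r,j)` equals
`(1/2)(w(i,i₁,i_r,j) - w(i,i_r,i₁,j) + ∑_{s=1}^{r-1}(w(i,i_s,i_{s+1},j) + w(i,i_{s+1},i_s,j)))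
  - ∑_{s=2}^{r-1} w(i,i_s,j)`. -/
theorem stmt_4 (n : ℕ) (w : Fin n → Fin n → ℝ) (hw : ∀ a b, w a b = w b a)
    (i j : Fin n) (hij : i ≠ j) (r : ℕ) (hr : 2 ≤ r) (e : ℕ → Fin n)
    (hinj : ∀ s < r, ∀ t < r, e s = e t → s = t)
    (havoid : ∀ s < r, e s ≠ i ∧ e s ≠ j) :
    pathWeight w ([i] ++ (List.range r).map e ++ [j]) =
      (1 / 2) * (pathWeight w [i, e 0, e (r - 1), j] - pathWeight w [i, e (r - 1), e 0, j]
        + ∑ s ∈ Finset.range (r - 1),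
            (pathWeight w [i, e s, e (s + 1), j] + pathWeight w [i, e (s + 1), e s, j]))
      - ∑ s ∈ Finset.Icc 1 (r - 2), pathWeight w [i, e s, j] := by
  obtain ⟨m, rfl⟩ : ∃ m, r = m + 2 := ⟨r - 2, by omega⟩
  have hpath : pathWeight w ([i] ++ (List.range (m + 2)).map e ++ [j]) =
      w i (e 0) + ∑ s ∈ Finset.range (m + 1), w (e s) (e (s + 1)) + w (e (m + 1)) j := by
    have h : [i] ++ (List.range (m + 2)).map e ++ [j] =
        ([i] ++ (List.range (m + 1)).map e) ++ [e (m + 1), j] := by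
      simp [List.range_succ]
    have h' : ([i] ++ (List.range (m + 1)).map e) ++ [e (m + 1)] =
        [i] ++ (List.range (m + 1 + 1)).map e := by
      simp [List.range_succ]
    rw [h, pathWeight_append_pair, h', pathWeight_append_singleton_map_range]
  have hsum : ∑ s ∈ Finset.range (m + 1),
        (pathWeight w [i, e s, e (s + 1), j] + pathWeight w [i, e (s + 1), e s, j]) =
      2 * ∑ s ∈ Finset.range (m + 1), w (e s) (e (s + 1)) +
        ∑ s ∈ Finset.range (m + 1),
          (pathWeight w [i, e s, j] + pathWeight w [i, e (s + 1), j]) := by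
    rw [Finset.mul_sum, ← Finset.sum_add_distrib]
    refine Finset.sum_congr rfl fun s _ => ?_
    simp only [pathWeight, hw (e (s + 1)) (e s)]
    ring
  rw [hpath, show m + 2 - 1 = m + 1 by omega, show m + 2 - 2 = m by omega, hsum,
    sum_range_add_succ (fun s => pathWeight w [i, e s, j])]
  simp only [pathWeight, hw (e (m + 1)) (e 0)]
  ring
end

section
/- Let n ≥ 2, let i, j ∈ [n] be distinct, and let Y be a multiset of real numbers of cardinality N_n. Then there exists a weighted complete graph G on vertex set [n] such that Y = D_{i,j}(G) if and only if there is a function y assigning to each simple path p from i to j in K_n a real number y_p, such that Y equals the multiset { y_p : p a simple path from i to j } and the following two conditions hold: (a) for every r ≥ 3 and all pairwise distinct i₁,…,i_r ∈ [n] ∖ {i,j}, y_{(i,i₁,…,i_r,j)} = (1/2)·( y_{(i,i₁,i_r,j)} − y_{(i,i_r,i₁,j)} + ∑_{s=1}^{r−1} ( y_{(i,i_s,i_{s+1},j)} + y_{(i,i_{s+1},i_s,j)} ) ) − ∑_{s=2}^{r−1} y_{(i,i_s,j)}; (b) for all pairwise distinct l, o, m ∈ [n] ∖ {i,j}, y_{(i,m,l,j)}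 + y_{(i,o,m,j)} + y_{(i,l,o,j)} = y_{(i,l,m,j)} + y_{(i,m,o,j)} + y_{(i,o,l,j)}. -/
theorem pathWeight_map_range_append {n : ℕ} (w : Fin n → Fin n → ℝ) (j : Fin n) (k : ℕ)
    (e : ℕ → Fin n) :
    pathWeight w ((List.range (k + 1)).map e ++ [j]) =
      ∑ s ∈ Finset.range k, w (e s) (e (s + 1)) + w (e k) j := by
  induction k generalizing e with
  | zero => simp [pathWeight]
  | succ k ih =>
    have h := ih (fun s => e (s + 1))
    rw [List.range_succ_eq_map] at h ⊢
    rw [List.range_succ_eq_map]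
    rw [Finset.sum_range_succ']
    simp only [List.map_cons, List.map_map, List.cons_append, pathWeight] at h ⊢
    simp only [Function.comp_def, Nat.succ_eq_add_one, zero_add] at h ⊢
    rw [h]
    ring

theorem sum_range_add_succ_eq (d : ℕ → ℝ) (k : ℕ) :
    ∑ s ∈ Finset.range (k + 1), (d s + d (s + 1)) =
      d 0 + d (k + 1) + 2 * ∑ s ∈ Finset.Icc 1 k, d s := by
  induction k with
  | zero => simp
  | succ k ih =>
    rw [Finset.sum_range_succ, ih, Finset.sum_Icc_succ_top (by omega)]
    ring

/-- Path weights of a symmetric weight are determined by the paths with at most two inner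
vertices. -/
theorem pathWeight_eq_of_symm {n : ℕ} (w : Fin n → Fin n → ℝ) (hw : ∀ a b, w a b = w b a)
    (i j : Fin n) (r : ℕ) (hr : 3 ≤ r) (e : ℕ → Fin n) :
    pathWeight w ([i] ++ (List.range r).map e ++ [j]) =
      (1 / 2) * (pathWeight w [i, e 0, e (r - 1), j] - pathWeight w [i, e (r - 1), e 0, j]
        + ∑ s ∈ Finset.range (r - 1),
            (pathWeight w [i, e s, e (s + 1), j] + pathWeight w [i, e (s + 1), e s, j]))
      - ∑ s ∈ Finset.Icc 1 (r - 2), pathWeight w [i, e s, j] := by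
  obtain ⟨k, rfl⟩ : ∃ k, r = k + 2 := ⟨r - 2, by omega⟩
  have hpath : pathWeight w ([i] ++ (List.range (k + 2)).map e ++ [j]) =
      w i (e 0) + pathWeight w ((List.range (k + 2)).map e ++ [j]) := by
    rw [List.range_succ_eq_map]
    simp [pathWeight]
  have hsum : ∑ s ∈ Finset.range (k + 1),
      (pathWeight w [i, e s, e (s + 1), j] + pathWeight w [i, e (s + 1), e s, j]) =
      2 * ∑ s ∈ Finset.range (k + 1), w (e s) (e (s + 1)) +
      ∑ s ∈ Finset.range (k + 1), (pathWeight w [i, e s, j] + pathWeight w [i, e (s + 1), j]) := by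
    rw [Finset.mul_sum, ← Finset.sum_add_distrib]
    refine Finset.sum_congr rfl fun s _ => ?_
    simp only [pathWeight]
    rw [hw (e (s + 1)) (e s)]
    ring
  rw [hpath, pathWeight_map_range_append w j (k + 1) e]
  simp only [Nat.add_sub_cancel, show k + 2 - 1 = k + 1 from rfl]
  rw [hsum, sum_range_add_succ_eq (fun s => pathWeight w [i, e s, j])]
  simp only [pathWeight]
  rw [hw (e (k + 1)) (e 0)]
  ring

theorem mem_pathFinset {n : ℕ} {i j : Fin n} {p : List (Fin n)} :
    p ∈ pathFinset n i j ↔ IsPath i j p := by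
  simp [pathFinset]

theorem IsPath.exists_inner {n : ℕ} {i j : Fin n} (hij : i ≠ j) {p : List (Fin n)}
    (hp : IsPath i j p) :
    ∃ L : List (Fin n), p = [i] ++ L ++ [j] ∧ L.Nodup ∧ ∀ x ∈ L, x ≠ i ∧ x ≠ j := by
  obtain ⟨hnd, hh, hl⟩ := hp
  cases p with
  | nil => simp at hh
  | cons a q =>
    obtain rfl : a = i := by simpa using hh
    rcases List.eq_nil_or_concat q with rfl | ⟨L, b, rfl⟩
    · simp at hl
      exact absurd hl hij
    · obtain rfl : b = j := by
        rw [List.concat_eq_append, ← List.cons_append, List.getLast?_append] at hl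
        simpa using hl
      refine ⟨L, by simp, ?_, ?_⟩
      · simp [List.nodup_append] at hnd
        exact hnd.2.1
      · intro x hx
        simp [List.nodup_append] at hnd
        exact ⟨fun h => hnd.1.1 (h ▸ hx), fun h => hnd.2.2 x hx h⟩

/-- The cocycle condition makes the antisymmetric part of `y` on paths with two inner vertices
a coboundary. -/
theorem exists_potential {n : ℕ} (i j : Fin n) (y : List (Fin n) → ℝ)
    (hb : ∀ l o m : Fin n, l ≠ i → l ≠ j → o ≠ i → o ≠ j → m ≠ i → m ≠ j →
      l ≠ o → l ≠ m → o ≠ m →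
      y [i, m, l, j] + y [i, o, m, j] + y [i, l, o, j]
        = y [i, l, m, j] + y [i, m, o, j] + y [i, o, l, j]) :
    ∃ c : Fin n → ℝ, ∀ u v, u ≠ i → u ≠ j → v ≠ i → v ≠ j → u ≠ v →
      c u - c v = y [i, u, v, j] - y [i, v, u, j] := by
  by_cases h : ∃ z : Fin n, z ≠ i ∧ z ≠ j
  · obtain ⟨z, hzi, hzj⟩ := h
    refine ⟨fun u => y [i, u, z, j] - y [i, z, u, j], fun u v hui huj hvi hvj huv => ?_⟩
    by_cases hu : u = z
    · subst hu; ring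
    by_cases hv : v = z
    · subst hv; ring
    have := hb u v z hui huj hvi hvj hzi hzj huv hu hv
    linarith
  · exact ⟨0, fun u v hui huj => absurd ⟨u, hui, huj⟩ h⟩

/-- There is a symmetric weight realising prescribed values on the paths with at most two inner
vertices. -/
theorem exists_symm_weight {n : ℕ} {i j : Fin n} (hij : i ≠ j) (y : List (Fin n) → ℝ)
    (hb : ∀ l o m : Fin n, l ≠ i → l ≠ j → o ≠ i → o ≠ j → m ≠ i → m ≠ j →
      l ≠ o → l ≠ m → o ≠ m →
      y [i, m, l, j] + y [i, o, m, j] + y [i, l, o, j]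
        = y [i, l, m, j] + y [i, m, o, j] + y [i, o, l, j]) :
    ∃ w : Fin n → Fin n → ℝ, (∀ a b, w a b = w b a) ∧
      pathWeight w [i, j] = y [i, j] ∧
      (∀ u, u ≠ i → u ≠ j → pathWeight w [i, u, j] = y [i, u, j]) ∧
      ∀ u v, u ≠ i → u ≠ j → v ≠ i → v ≠ j → u ≠ v →
        pathWeight w [i, u, v, j] = y [i, u, v, j] := by
  obtain ⟨c, hc⟩ := exists_potential i j y hb
  refine ⟨fun a b =>
    if a = i then (if b = j then y [i, j] else (y [i, b, j] + c b) / 2)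
    else if a = j then (if b = i then y [i, j] else (y [i, b, j] - c b) / 2)
    else if b = i then (y [i, a, j] + c a) / 2
    else if b = j then (y [i, a, j] - c a) / 2
    else (y [i, a, b, j] + y [i, b, a, j] - y [i, a, j] - y [i, b, j]) / 2,
    fun a b => ?_, ?_, fun u hui huj => ?_, fun u v hui huj hvi hvj huv => ?_⟩
  · dsimp only
    split_ifs <;> first | (subst_vars; first | rfl | contradiction) | ring
  · simp [pathWeight]
  · simp only [pathWeight, if_neg hui, if_neg huj, if_pos, if_neg hij.symm]
    ring
  · have := hc u v hui huj hvi hvj huv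
    simp only [pathWeight, if_neg hui, if_neg huj, if_neg hvi, if_neg hvj, if_pos,
      if_neg hij.symm]
    linarith

/-- For a multiset `Y` of reals of cardinality `N_n`, there is a weighted complete
graph `G` on `[n]` with `Y = D_{i,j}(G)` iff the elements of `Y` can be indexed by the simple
paths from `i` to `j` so that conditions (a) and (b) hold. -/
theorem stmt_6 (n : ℕ) (hn : 2 ≤ n) (i j : Fin n) (hij : i ≠ j)
    (Y : Multiset ℝ) (hY : Multiset.card Y = Nn n) :
    (∃ w : Fin n → Fin n → ℝ, (∀ a b, w a b = w b a) ∧ Y = DG n w i j) ↔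
    (∃ y : List (Fin n) → ℝ,
      Y = (pathFinset n i j).val.map y ∧
      (∀ r : ℕ, 3 ≤ r → ∀ e : ℕ → Fin n,
        (∀ s < r, ∀ t < r, e s = e t → s = t) → (∀ s < r, e s ≠ i ∧ e s ≠ j) →
        y ([i] ++ (List.range r).map e ++ [j]) =
          (1 / 2) * (y [i, e 0, e (r - 1), j] - y [i, e (r - 1), e 0, j]
            + ∑ s ∈ Finset.range (r - 1),
                (y [i, e s, e (s + 1), j] + y [i, e (s + 1), e s, j]))
          - ∑ s ∈ Finset.Icc 1 (r - 2), y [i, e s, j]) ∧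
      (∀ l o m : Fin n, l ≠ i → l ≠ j → o ≠ i → o ≠ j → m ≠ i → m ≠ j →
        l ≠ o → l ≠ m → o ≠ m →
        y [i, m, l, j] + y [i, o, m, j] + y [i, l, o, j]
          = y [i, l, m, j] + y [i, m, o, j] + y [i, o, l, j])) := by
  constructor
  · rintro ⟨w, hw, rfl⟩
    refine ⟨pathWeight w, rfl, fun r hr e _ _ => pathWeight_eq_of_symm w hw i j r hr e, ?_⟩
    intro l o m _ _ _ _ _ _ _ _ _
    simp only [pathWeight]
    rw [hw m l, hw o m, hw l o]
    ring
  · rintro ⟨y, rfl, ha, hb⟩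
    obtain ⟨w, hw, h2, h3, h4⟩ := exists_symm_weight hij y hb
    refine ⟨w, hw, Multiset.map_congr rfl fun p hp => ?_⟩
    obtain ⟨L, rfl, hL, hLij⟩ := (mem_pathFinset.1 hp).exists_inner hij
    match L, hL, hLij with
    | [], _, _ => exact h2.symm
    | [u], _, h => exact (h3 u (h u (by simp)).1 (h u (by simp)).2).symm
    | [u, v], hnd, h =>
      exact (h4 u v (h u (by simp)).1 (h u (by simp)).2 (h v (by simp)).1 (h v (by simp)).2
        (by simpa using hnd)).symm
    | a :: b :: c :: M, hnd, h =>
      generalize hK : a :: b :: c :: M = K at hnd h ⊢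
      have hr : 3 ≤ K.length := by simp [← hK]
      have hget : ∀ s (hs : s < K.length), K.getD s i = K[s] := fun s hs => by simp [hs]
      have hmap : (List.range K.length).map (fun s => K.getD s i) = K := by
        refine List.ext_getElem (by simp) fun s h₁ h₂ => ?_
        simp [h₂]
      have hinj : ∀ s < K.length, ∀ t < K.length, K.getD s i = K.getD t i → s = t := by
        intro s hs t ht hst
        rw [hget s hs, hget t ht] at hst
        exact (hnd.getElem_inj_iff).1 hst
      have havoid : ∀ s < K.length, K.getD s i ≠ i ∧ K.getD s i ≠ j := by
        intro s hs
        rw [hget s hs]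
        exact h _ (List.getElem_mem hs)
      have hpair : ∀ s t, s < K.length → t < K.length → s ≠ t →
          pathWeight w [i, K.getD s i, K.getD t i, j] = y [i, K.getD s i, K.getD t i, j] :=
        fun s t hs ht hst => h4 _ _ (havoid s hs).1 (havoid s hs).2 (havoid t ht).1
          (havoid t ht).2 fun h' => hst (hinj s hs t ht h')
      have hy := ha K.length hr (fun s => K.getD s i) hinj havoid
      have hp := pathWeight_eq_of_symm w hw i j K.length hr (fun s => K.getD s i)
      rw [hmap] at hy hp
      rw [hy, hp, hpair _ _ (by omega) (by omega) (by omega),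
        hpair _ _ (by omega) (by omega) (by omega)]
      congr 1
      · congr 2
        refine Finset.sum_congr rfl fun s hs => ?_
        have hs' := Finset.mem_range.1 hs
        rw [hpair _ _ (by omega) (by omega) (by omega),
          hpair _ _ (by omega) (by omega) (by omega)]
      · refine Finset.sum_congr rfl fun s hs => ?_
        have hs' := Finset.mem_Icc.1 hs
        exact (h3 _ (havoid s (by omega)).1 (havoid s (by omega)).2).symm
end

section
/- Let n ≥ 4 and let i, j ∈ [n] be distinct. Suppose given real numbers y_{(i,l,j)} for each l ∈ [n] ∖ {i,j} and y_{(i,l,m,j)} for each ordered pair of distinct l, m ∈ [n] ∖ {i,j}, and define, for distinct l, m ∈ [n] ∖ {i,j}, w(l,m) := (1/2)·( y_{(i,l,m,j)} + y_{(i,m,l,j)} − y_{(i,l,j)} − y_{(i,m,j)} ). Then the following are equivalent: (1) there exist functions a, b : [n] ∖ {i,j} → ℝ such that a(l) + b(l) = y_{(i,l,j)} for every l, and a(m) + b(l) = y_{(i,m,l,j)} − w(l,m) for all distinct l, m; (2) for all pairwise distinct l, o, m ∈ [n] ∖ {i,j}, y_{(i,m,l,j)} + y_{(i,o,m,j)}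 + y_{(i,l,o,j)} = y_{(i,l,m,j)} + y_{(i,m,o,j)} + y_{(i,o,l,j)}. -/
/-- With `w(l,m) := (1/2)(y₃(l,m) + y₃(m,l) - y₂ l - y₂ m)`, the linear system
`a l + b l = y₂ l`, `a m + b l = y₃(m,l) - w(l,m)` (over `l, m ∈ [n] ∖ {i,j}` distinct) is
solvable iff `y₃(m,l) + y₃(o,m) + y₃(l,o) = y₃(l,m) + y₃(m,o) + y₃(o,l)` for all pairwise
distinct `l, o, m ∈ [n] ∖ {i,j}`.  Here `y₂ l` stands for `y_{(i,l,j)}` and `y₃ l m` stands for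
`y_{(i,l,m,j)}`. -/
theorem stmt_8 (n : ℕ) (hn : 4 ≤ n) (i j : Fin n) (hij : i ≠ j)
    (y2 : Fin n → ℝ) (y3 : Fin n → Fin n → ℝ) :
    (∃ a b : Fin n → ℝ,
      (∀ l : Fin n, l ≠ i → l ≠ j → a l + b l = y2 l) ∧
      (∀ l m : Fin n, l ≠ i → l ≠ j → m ≠ i → m ≠ j → l ≠ m →
        a m + b l = y3 m l - (1 / 2) * (y3 l m + y3 m l - y2 l - y2 m))) ↔
    (∀ l o m : Fin n, l ≠ i → l ≠ j → o ≠ i → o ≠ j → m ≠ i → m ≠ j →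
      l ≠ o → l ≠ m → o ≠ m →
      y3 m l + y3 o m + y3 l o = y3 l m + y3 m o + y3 o l) := by
  constructor
  · rintro ⟨a, b, h2, h3⟩ l o m hli hlj hoi hoj hmi hmj hlo hlm hom
    linarith [h2 l hli hlj, h2 o hoi hoj, h2 m hmi hmj,
      h3 l m hli hlj hmi hmj hlm, h3 m o hmi hmj hoi hoj hom.symm, h3 o l hoi hoj hli hlj hlo.symm]
  · intro h
    obtain ⟨k, hk⟩ : ∃ k, k ∉ ({i, j} : Finset (Fin n)) := by
      by_contra! hall
      have hcard := Finset.card_le_card (Finset.subset_iff.2 fun x _ => hall x :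
        (Finset.univ : Finset (Fin n)) ⊆ {i, j})
      rw [Finset.card_univ, Fintype.card_fin] at hcard
      have := Finset.card_le_two (a := i) (b := j)
      omega
    obtain ⟨hki, hkj⟩ : k ≠ i ∧ k ≠ j := by simpa using hk
    refine ⟨fun l => (y2 l + (y3 l k - y3 k l)) / 2, fun l => (y2 l - (y3 l k - y3 k l)) / 2,
      fun l _ _ => by ring, fun l m hli hlj hmi hmj hlm => ?_⟩
    by_cases hlk : l = k
    · subst hlk
      ring
    by_cases hmk : m = k
    · subst hmk
      ring
    linarith [h l k m hli hlj hki hkj hmi hmj hlk hlm (Ne.symm hmk)]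
end

section
/- Let n ≥ 3, let G be a weighted complete graph on [n] with edge-weight function w, let i, j, k ∈ [n] be pairwise distinct, and let f be the bijection from simple paths between i and k to simple paths between j and k defined by f(i,δ,k) = (j,δ,k) and f(i,γ,j,η,k) = (j,γ^{−1},i,η,k). Then: (1) w(i,k) − w(f(i,k)) = w({i,k}) − w({j,k}); (2) for every path p = (i,γ,j,k), w(p) − w(f(p)) = −( w({i,k}) − w({j,k}) ); (3) for every path p = (i,η,k) with η nonempty avoiding j and with first vertex r, w(p) − w(f(p)) = w({i,r}) − w({j,r}); (4) for every path p = (i,γ,j,η,k) with η nonempty and with first vertex of η equal to r, w(p) − w(f(p)) = −( w({i,r}) − w({j,r}) ). -/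
/-- A path weight splits at any vertex of the path. -/
theorem pathWeight_append_cons {n : ℕ} (w : Fin n → Fin n → ℝ) (l : List (Fin n)) (a : Fin n)
    (m : List (Fin n)) :
    pathWeight w (l ++ a :: m) = pathWeight w (l ++ [a]) + pathWeight w (a :: m) := by
  induction l with
  | nil => simp [pathWeight]
  | cons b l ih =>
    cases l with
    | nil => simp [pathWeight]
    | cons c l =>
      simp only [List.cons_append, pathWeight] at ih ⊢
      rw [ih, add_assoc]

/-- For symmetric weights, a path and its reversal have the same weight. -/
theorem pathWeight_reverse {n : ℕ} {w : Fin n → Fin n → ℝ} (hw : ∀ a b, w a b = w b a)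
    (l : List (Fin n)) : pathWeight w l.reverse = pathWeight w l := by
  induction l with
  | nil => rfl
  | cons a l ih =>
    cases l with
    | nil => rfl
    | cons b l =>
      rw [List.reverse_cons] at ih
      rw [List.reverse_cons, List.reverse_cons, List.append_assoc, List.singleton_append,
        pathWeight_append_cons, ih]
      simp only [pathWeight, hw b a]
      ring

/-- Reversing the initial segment `(i, γ, j)` of a path `(i, γ, j, r, m)` only replaces the edge
`{j, r}` by `{i, r}`. -/
theorem pathWeight_sub_reverse_segment {n : ℕ} {w : Fin n → Fin n → ℝ}
    (hw : ∀ a b, w a b = w b a) (i j r : Fin n) (γ m : List (Fin n)) :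
    pathWeight w (i :: γ ++ j :: r :: m) - pathWeight w (j :: γ.reverse ++ i :: r :: m) =
      -(w i r - w j r) := by
  have h := pathWeight_reverse hw (i :: γ ++ [j])
  have hrev : (i :: γ ++ [j]).reverse = j :: γ.reverse ++ [i] := by simp
  rw [hrev] at h
  rw [pathWeight_append_cons, pathWeight_append_cons w (j :: γ.reverse), h]
  simp only [pathWeight]
  ring

/-- For the bijection `f` (with `f(i,δ,k) = (j,δ,k)`,
`f(i,γ,j,η,k) = (j,γ⁻¹,i,η,k)`) one has: (1) `w(i,k) - w(f(i,k)) = w({i,k}) - w({j,k})`;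
(2) for `p = (i,γ,j,k)`, `w(p) - w(f(p)) = -(w({i,k}) - w({j,k}))`; (3) for `p = (i,η,k)` with
`η` nonempty avoiding `j` with first vertex `r`, `w(p) - w(f(p)) = w({i,r}) - w({j,r})`;
(4) for `p = (i,γ,j,η,k)` with `η` nonempty with first vertex `r`,
`w(p) - w(f(p)) = -(w({i,r}) - w({j,r}))`. -/
theorem stmt_10 (n : ℕ) (hn : 3 ≤ n) (w : Fin n → Fin n → ℝ) (hw : ∀ a b, w a b = w b a)
    (i j k : Fin n) (hij : i ≠ j) (hik : i ≠ k) (hjk : j ≠ k)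
    (f : List (Fin n) → List (Fin n))
    (hf1 : ∀ δ : List (Fin n), IsPath i k ([i] ++ δ ++ [k]) → j ∉ δ →
      f ([i] ++ δ ++ [k]) = [j] ++ δ ++ [k])
    (hf2 : ∀ γ η : List (Fin n), IsPath i k ([i] ++ γ ++ [j] ++ η ++ [k]) →
      f ([i] ++ γ ++ [j] ++ η ++ [k]) = [j] ++ γ.reverse ++ [i] ++ η ++ [k]) :
    (pathWeight w [i, k] - pathWeight w (f [i, k]) = w i k - w j k) ∧
    (∀ γ : List (Fin n), IsPath i k ([i] ++ γ ++ [j] ++ [k]) →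
      pathWeight w ([i] ++ γ ++ [j] ++ [k]) - pathWeight w (f ([i] ++ γ ++ [j] ++ [k]))
        = -(w i k - w j k)) ∧
    (∀ r : Fin n, ∀ η : List (Fin n), IsPath i k ([i] ++ (r :: η) ++ [k]) → j ∉ r :: η →
      pathWeight w ([i] ++ (r :: η) ++ [k]) - pathWeight w (f ([i] ++ (r :: η) ++ [k]))
        = w i r - w j r) ∧
    (∀ γ : List (Fin n), ∀ r : Fin n, ∀ η : List (Fin n),
      IsPath i k ([i] ++ γ ++ [j] ++ (r :: η) ++ [k]) →
      pathWeight w ([i] ++ γ ++ [j] ++ (r :: η) ++ [k])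
        - pathWeight w (f ([i] ++ γ ++ [j] ++ (r :: η) ++ [k]))
        = -(w i r - w j r)) := by
  refine ⟨?_, fun γ hp => ?_, fun r η hp hj => ?_, fun γ r η hp => ?_⟩
  · have h : f [i, k] = [j, k] := hf1 [] (by simp [IsPath, hik]) (by simp)
    rw [h]
    simp [pathWeight]
  · have h := hf2 γ [] (by simpa using hp)
    simp only [List.append_nil] at h
    rw [h]
    simpa using pathWeight_sub_reverse_segment hw i j k γ []
  · rw [hf1 _ hp hj]
    simp [pathWeight]
  · rw [hf2 _ _ hp]
    simpa using pathWeight_sub_reverse_segment hw i j r γ (η ++ [k])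
end

section
/- Let n ≥ 4, let i, j, k ∈ [n] be pairwise distinct, and let r ∈ [n] ∖ {i,j,k}. The number of simple paths between i and k in K_n that are either of the form (i,η,k) with η a nonempty sequence of distinct vertices of [n] ∖ {i,j,k} whose first vertex is r, or of the form (i,γ,j,η,k) with γ, η disjoint sequences of distinct vertices of [n] ∖ {i,j,k}, η nonempty with first vertex r, equals N_{n−1}, where N_m := ∑_{k=1}^{m−1} (m−2)!/(m−1−k)!. -/
/-- The number of duplicate-free lists with entries in a finite set. -/
theorem card_nodup_list_of_finset {α : Type*} (s : Finset α) :
    Nat.card {l : List α // l.Nodup ∧ ∀ x ∈ l, x ∈ s} =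
      ∑ m ∈ Finset.range (s.card + 1), s.card.descFactorial m := by
  classical
  let f : (Σ m : Fin (s.card + 1), Fin m ↪ s) → {l : List α // l.Nodup ∧ ∀ x ∈ l, x ∈ s} :=
    fun a => ⟨List.ofFn fun t => (a.2 t : α),
      List.nodup_ofFn.2 (Subtype.val_injective.comp a.2.injective), by
        intro x hx
        obtain ⟨t, rfl⟩ := List.mem_ofFn.1 hx
        exact (a.2 t).2⟩
  have hf : Function.Bijective f := by
    constructor
    · rintro ⟨⟨m, hm⟩, e⟩ ⟨⟨m', hm'⟩, e'⟩ h
      have h' := congrArg Subtype.val h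
      simp only [f] at h'
      obtain rfl : m = m' := by simpa using congrArg List.length h'
      have h'' := List.ofFn_injective h'
      obtain rfl : e = e' := by
        ext t
        exact congrFun h'' t
      rfl
    · rintro ⟨l, hl, hs⟩
      have hlen : l.length ≤ s.card := by
        rw [← List.toFinset_card_of_nodup hl]
        exact Finset.card_le_card fun x hx => hs x (List.mem_toFinset.1 hx)
      refine ⟨⟨⟨l.length, by omega⟩, ⟨fun t => ⟨l.get t, hs _ (l.get_mem t)⟩, ?_⟩⟩, ?_⟩
      · intro a b hab
        exact hl.injective_get (congrArg Subtype.val hab)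
      · exact Subtype.ext (List.ofFn_get l)
  rw [← Nat.card_congr (Equiv.ofBijective f hf), Nat.card_eq_fintype_card, Fintype.card_sigma,
    Finset.sum_range]
  simp [Fintype.card_embedding_eq]

theorem Nn_add_two (m : ℕ) : Nn (m + 2) = ∑ t ∈ Finset.range (m + 1), m.descFactorial t := by
  rw [Nn, Finset.range_eq_Ico]
  have h : Finset.Icc 1 (m + 2 - 1) = Finset.Ico (0 + 1) (m + 1 + 1) := by
    ext x
    simp only [Finset.mem_Icc, Finset.mem_Ico]
    omega
  rw [h, ← Finset.sum_Ico_add' _ 0 (m + 1) 1]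
  refine Finset.sum_congr rfl fun t ht => ?_
  rw [Finset.mem_Ico] at ht
  rw [Nat.descFactorial_eq_div (by omega)]
  congr 2
  omega

/-- For `r ∈ [n] ∖ {i,j,k}`, the number of simple paths between `i` and `k` of the
form `(i,η,k)` with `η` nonempty avoiding `j` with first vertex `r`, or `(i,γ,j,η,k)` with `η`
nonempty with first vertex `r`, equals `N_{n-1}`. -/
theorem stmt_12 (n : ℕ) (hn : 4 ≤ n) (i j k : Fin n)
    (hij : i ≠ j) (hik : i ≠ k) (hjk : j ≠ k)
    (r : Fin n) (hri : r ≠ i) (hrj : r ≠ j) (hrk : r ≠ k) :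
    Nat.card {p : List (Fin n) // IsPath i k p ∧
      ((∃ η : List (Fin n), j ∉ η ∧ p = [i] ++ (r :: η) ++ [k]) ∨
       (∃ γ η : List (Fin n), p = [i] ++ γ ++ [j] ++ (r :: η) ++ [k]))} = Nn (n - 1) := by
  have hcard : (Finset.univ \ {i, k, r} : Finset (Fin n)).card = n - 3 := by
    rw [Finset.card_sdiff_of_subset (Finset.subset_univ _), Finset.card_univ, Fintype.card_fin,
      Finset.card_eq_three.2 ⟨i, k, r, hik, hri.symm, hrk.symm, rfl⟩]
  have hcount := card_nodup_list_of_finset (Finset.univ \ {i, k, r} : Finset (Fin n))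
  rw [hcard, ← Nn_add_two, show n - 3 + 2 = n - 1 by omega] at hcount
  rw [← hcount]
  have hfilter : ∀ l : List (Fin n), i ∉ l → k ∉ l → r ∉ l →
      l.filter (fun x => x ∉ ({i, k, r} : Finset (Fin n))) = l := by
    intro l hi hk hr
    rw [List.filter_eq_self]
    intro x hx
    have h1 : x ≠ i := fun h => hi (h ▸ hx)
    have h2 : x ≠ k := fun h => hk (h ▸ hx)
    have h3 : x ≠ r := fun h => hr (h ▸ hx)
    simp [h1, h2, h3]
  have hdirect : ∀ η : List (Fin n), ([i] ++ (r :: η) ++ [k]).Nodup →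
      ([i] ++ (r :: η) ++ [k]).filter (fun x => x ∉ ({i, k, r} : Finset (Fin n))) = η := by
    intro η h
    have := hfilter η (by grind) (by grind) (by grind)
    simpa using this
  have hthrough : ∀ γ η : List (Fin n), ([i] ++ γ ++ [j] ++ (r :: η) ++ [k]).Nodup →
      ([i] ++ γ ++ [j] ++ (r :: η) ++ [k]).filter
        (fun x => x ∉ ({i, k, r} : Finset (Fin n))) = γ ++ j :: η := by
    intro γ η h
    have h1 := hfilter γ (by grind) (by grind) (by grind)
    have h2 := hfilter η (by grind) (by grind) (by grind)
    have h3 : (r :: η).filter (fun x => x ∉ ({i, k, r} : Finset (Fin n))) = η := by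
      simpa using h2
    rw [List.filter_append, List.filter_append, List.filter_append, List.filter_append, h1, h3]
    simp [hij.symm, hjk, hrj.symm]
  have hmem : ∀ γ η : List (Fin n), ([i] ++ γ ++ [j] ++ (r :: η) ++ [k]).Nodup →
      j ∉ γ ∧ j ∉ η := by
    intro γ η h
    simp only [List.nodup_append, List.mem_append, List.mem_cons] at h
    grind
  refine Nat.card_congr (Equiv.ofBijective (fun p =>
    ⟨p.1.filter (fun x => x ∉ ({i, k, r} : Finset (Fin n))), p.2.1.1.filter _, ?_⟩) ⟨?_, ?_⟩)
  · intro x hx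
    simpa using (List.mem_filter.1 hx).2
  · rintro ⟨p, ⟨hp, _⟩, h⟩ ⟨q, ⟨hq, _⟩, h'⟩ hpq
    replace hpq := congrArg Subtype.val hpq
    refine Subtype.ext ?_
    dsimp only at hpq ⊢
    rcases h with ⟨η, hη, rfl⟩ | ⟨γ, η, rfl⟩ <;> rcases h' with ⟨η', hη', rfl⟩ | ⟨γ', η', rfl⟩
    · rw [hdirect η hp, hdirect η' hq] at hpq
      rw [hpq]
    · rw [hdirect η hp, hthrough γ' η' hq] at hpq
      simp [hpq] at hη
    · rw [hthrough γ η hp, hdirect η' hq] at hpq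
      simp [← hpq] at hη'
    · rw [hthrough γ η hp, hthrough γ' η' hq] at hpq
      obtain ⟨h1, h3⟩ := hmem γ η hp
      obtain ⟨h2, h4⟩ := hmem γ' η' hq
      obtain ⟨rfl, rfl⟩ : γ = γ' ∧ η = η' := by
        rcases List.append_eq_append_iff.1 hpq with ⟨_ | ⟨a, l⟩, h, h'⟩ | ⟨_ | ⟨a, l⟩, h, h'⟩ <;>
          grind
      rfl
  · rintro ⟨l, hl, hs⟩
    have hi : i ∉ l := fun h => by simpa using hs i h
    have hk : k ∉ l := fun h => by simpa using hs k h
    have hr : r ∉ l := fun h => by simpa using hs r h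
    by_cases hj : j ∈ l
    · obtain ⟨γ, η, rfl⟩ := List.append_of_mem hj
      have hnd : ([i] ++ γ ++ [j] ++ (r :: η) ++ [k]).Nodup := by
        clear hcount hcard hfilter hdirect hthrough hmem hs hj
        simp only [List.nodup_append, List.nodup_cons, List.mem_append, List.mem_cons,
          List.not_mem_nil, List.nodup_nil, or_false] at hl hi hk hr ⊢
        grind
      exact ⟨⟨_, ⟨hnd, by simp, List.getLast?_concat⟩, Or.inr ⟨γ, η, rfl⟩⟩, Subtype.ext (hthrough γ η hnd)⟩
    · have hnd : ([i] ++ (r :: l) ++ [k]).Nodup := by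
        clear hcount hcard hfilter hdirect hthrough hmem hs
        simp only [List.nodup_append, List.nodup_cons, List.mem_append, List.mem_cons,
          List.not_mem_nil, List.nodup_nil, or_false]
        grind
      exact ⟨⟨_, ⟨hnd, by simp, List.getLast?_concat⟩, Or.inl ⟨l, hj, rfl⟩⟩, Subtype.ext (hdirect l hnd)⟩
end
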